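/- arXiv:2008.09489 — 2 statements merged into one kernel-verified Lean document; each statement's English description precedes it below -/
import Mathlib

section
/- Let G be a group, (U_m)_{m≥0} a decreasing sequence of normal subgroups of G, and w : ℕ → [0, ∞) a family of nonnegative real weights. For irreducible finite-dimensional complex representations π, π' of G set inv(π, π') := Σ_{m=1}^∞ w_m · dim Hom_{U_m}(π, π') (a sum in [0, ∞]). Fix real numbers q > 1 and v > 0, and for a pair with 0 < inv(π, π') < ∞ define the normalized conductor f̃(π, π') := −log( v² · inv(π, π') / (d_π d_{π'}) ) / log q. Let π₁, π₂, π₃ be irreducible finite-dimensional complex representations of G such that inv(π_i, π_j) < ∞ for all pairs i, j ∈ {1,2,3} and inv(π₁, π₂) > 0 and inv(π₂, π₃) > 0. Then inv(π₁, π₃) > 0 and f̃(π₁, π₃) ≤ max( f̃(π₁, π₂), f̃(π₂, π₃) ). -/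
variable {G : Type*} [Group G]

/-- A finite-dimensional complex representation is irreducible if it is nonzero and has no
invariant subspace other than `⊥` and `⊤`. -/
def IsIrrep {V : Type*} [AddCommGroup V] [Module ℂ V] (ρ : Representation ℂ G V) : Prop :=
  Nontrivial V ∧ ∀ p : Submodule ℂ V, (∀ g : G, ∀ v ∈ p, ρ g v ∈ p) → p = ⊥ ∨ p = ⊤

/-- The space of linear maps intertwining the restrictions to a subgroup `H`. -/
def homSpace (H : Subgroup G) {V₁ V₂ : Type*} [AddCommGroup V₁] [Module ℂ V₁]
    [AddCommGroup V₂] [Module ℂ V₂] (ρ₁ : Representation ℂ G V₁)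
    (ρ₂ : Representation ℂ G V₂) : Submodule ℂ (V₁ →ₗ[ℂ] V₂) where
  carrier := {f | ∀ h ∈ H, ∀ v, f (ρ₁ h v) = ρ₂ h (f v)}
  add_mem' := by
    intro f g hf hg h hh v
    simp [hf h hh v, hg h hh v]
  zero_mem' := by intro h hh v; simp
  smul_mem' := by
    intro c f hf h hh v
    simp [hf h hh v]


open scoped ENNReal NNReal

/-- `inv(π, π') = Σ_{m=1}^∞ w_m · dim Hom_{U_m}(π, π')`, a sum in `[0, ∞]`,
for nonnegative real weights `w : ℕ → [0, ∞)`. -/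
noncomputable def invW (U : ℕ → Subgroup G) (w : ℕ → ℝ≥0) {V₁ V₂ : Type*}
    [AddCommGroup V₁] [Module ℂ V₁] [AddCommGroup V₂] [Module ℂ V₂]
    (ρ₁ : Representation ℂ G V₁) (ρ₂ : Representation ℂ G V₂) : ℝ≥0∞ :=
  ∑' m : ℕ, (w (m + 1) : ℝ≥0∞) * (Module.finrank ℂ (homSpace (U (m + 1)) ρ₁ ρ₂) : ℝ≥0∞)

/-- The normalized conductor `f̃ = −log(v² · inv / (d d')) / log q`. -/
noncomputable def ftilde (q v : ℝ) (I : ℝ≥0∞) (d d' : ℕ) : ℝ :=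
  -Real.log (v ^ 2 * I.toReal / ((d : ℝ) * (d' : ℝ))) / Real.log q

open Module

section SimpleSubmodules

theorem IsSimpleModule.of_semilinear {k A V W : Type*} [Field k] [Ring A] [Algebra k A]
    [AddCommGroup V] [Module k V] [Module A V] [AddCommGroup W] [Module k W] [Module A W]
    (σ : A ≃ₐ[k] A) (e : V ≃ₗ[k] W)
    (he : ∀ (a : A) v, e (a • v) = σ a • e v) [IsSimpleModule A V] : IsSimpleModule A W := by
  have : RingHomSurjective (σ : A →+* A) := ⟨σ.surjective⟩
  let l : V →ₛₗ[(σ : A →+* A)] W :=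
    { toFun := e, map_add' := map_add e, map_smul' := he }
  exact (LinearMap.isSimpleModule_iff_of_bijective l e.bijective).1 inferInstance

variable {k A : Type*} [Field k] [Ring A] [Algebra k A]
  {V W X Y : Type*} [AddCommGroup V] [Module k V] [Module A V] [IsScalarTower k A V]
  [AddCommGroup W] [Module k W] [Module A W] [IsScalarTower k A W]
  [AddCommGroup X] [Module k X] [Module A X] [IsScalarTower k A X]
  [AddCommGroup Y] [Module k Y] [Module A Y] [IsScalarTower k A Y]

variable (k A V X) in
theorem finiteDimensional_hom_of_tower [FiniteDimensional k V] [FiniteDimensional k X] :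
    FiniteDimensional k (V →ₗ[A] X) :=
  FiniteDimensional.of_injective (LinearMap.restrictScalarsₗ k A V X k)
    (LinearMap.restrictScalars_injective k)

/-- Transport of `A`-linear maps along isomorphisms which are semilinear for the same
automorphism `σ` of `A`. -/
def semilinearHomCongr (σ : A ≃ₐ[k] A) (e : V ≃ₗ[k] W) (he : ∀ (a : A) v, e (a • v) = σ a • e v)
    (t : X ≃ₗ[k] Y) (ht : ∀ (a : A) x, t (a • x) = σ a • t x) :
    (V →ₗ[A] X) ≃ₗ[k] (W →ₗ[A] Y) where
  toFun f :=
    { toFun := fun w => t (f (e.symm w))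
      map_add' := by simp
      map_smul' := fun a w => by
        have h : e.symm (a • w) = σ.symm a • e.symm w := by
          rw [LinearEquiv.symm_apply_eq, he]; simp
        simp [h, ht] }
  invFun f :=
    { toFun := fun v => t.symm (f (e v))
      map_add' := by simp
      map_smul' := fun a v => by
        rw [he, map_smul, RingHom.id_apply, LinearEquiv.symm_apply_eq, ht,
          LinearEquiv.apply_symm_apply] }
  map_add' f g := by ext; simp
  map_smul' c f := by ext; simp
  left_inv f := by ext; simp
  right_inv f := by ext; simp

/-- The image of an `A`-submodule under a semilinear automorphism. -/
def Submodule.translate (σ : A ≃ₐ[k] A) (e : V ≃ₗ[k] V) (he : ∀ (a : A) v, e (a • v) = σ a • e v)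
    (M : Submodule A V) : Submodule A V where
  toAddSubmonoid := ((M.restrictScalars k).map (e : V →ₗ[k] V)).toAddSubmonoid
  smul_mem' a x hx := by
    obtain ⟨m, hm, rfl⟩ := hx
    refine ⟨σ.symm a • m, M.smul_mem _ hm, ?_⟩
    simp [he]

/-- A submodule is isomorphic to its translate, semilinearly. -/
noncomputable def Submodule.translateEquiv (σ : A ≃ₐ[k] A) (e : V ≃ₗ[k] V)
    (he : ∀ (a : A) v, e (a • v) = σ a • e v) (M : Submodule A V) :
    M ≃ₗ[k] M.translate σ e he :=
  e.submoduleMap (M.restrictScalars k)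

theorem Submodule.translateEquiv_smul (σ : A ≃ₐ[k] A) (e : V ≃ₗ[k] V)
    (he : ∀ (a : A) v, e (a • v) = σ a • e v) (M : Submodule A V) (a : A) (m : M) :
    M.translateEquiv σ e he (a • m) = σ a • M.translateEquiv σ e he m :=
  Subtype.ext (he a m)

/-- If `V` is spanned by simple submodules which all have the same dimension and the same
dimensions of homomorphism spaces to and from `X`, then dimensions of homomorphism spaces
to and from `X` are proportional to dimensions. -/
theorem finrank_hom_of_iSup_simple_eq_top [FiniteDimensional k V] [FiniteDimensional k X]
    {ι : Type*} (S : ι → Submodule A V) (hS : ∀ i, IsSimpleModule A (S i))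
    (htop : ⨆ i, S i = ⊤) {a b c : ℕ} (ha : ∀ i, finrank k (S i) = a)
    (hb : ∀ i, finrank k (S i →ₗ[A] X) = b) (hc : ∀ i, finrank k (X →ₗ[A] S i) = c) :
    a * finrank k (V →ₗ[A] X) = finrank k V * b ∧
      a * finrank k (X →ₗ[A] V) = finrank k V * c := by
  have fin_sub (M : Submodule A V) : FiniteDimensional k M :=
    inferInstanceAs (FiniteDimensional k (M.restrictScalars k))
  let P : Set (Submodule A V) := {M | a * finrank k (M →ₗ[A] X) = finrank k M * b ∧
    a * finrank k (X →ₗ[A] M) = finrank k M * c}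
  have hbot : ⊥ ∈ P := by
    have h₁ : finrank k ((⊥ : Submodule A V) →ₗ[A] X) = 0 := finrank_zero_of_subsingleton
    have h₂ : finrank k (X →ₗ[A] (⊥ : Submodule A V)) = 0 := finrank_zero_of_subsingleton
    have h₃ : finrank k (⊥ : Submodule A V) = 0 := finrank_zero_of_subsingleton
    simp only [P, Set.mem_ofPred_eq, h₁, h₂, h₃]
    simp
  have : IsNoetherian A V := isNoetherian_of_tower k inferInstance
  obtain ⟨M, hM, hmax⟩ := WellFounded.has_min
    (wellFounded_gt : WellFounded ((· > ·) : Submodule A V → Submodule A V → Prop)) P ⟨⊥, hbot⟩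
  have hle (i : ι) : S i ≤ M := by
    by_contra hi
    have hdisj : Disjoint M (S i) :=
      ((isSimpleModule_iff_isAtom.1 (hS i)).not_le_iff_disjoint.1 hi).symm
    refine hmax (M ⊔ S i) ?_ (left_lt_sup.2 hi)
    let e₀ : (M × S i) →ₗ[A] V := M.subtype.coprod (S i).subtype
    have hinj : Function.Injective e₀ := by
      rw [← LinearMap.ker_eq_bot, LinearMap.ker_coprod_of_disjoint_range _ _ (by simpa using hdisj)]
      simp
    have hrange : LinearMap.range e₀ = M ⊔ S i := by
      simp [e₀, LinearMap.range_coprod]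
    let e : (M × S i) ≃ₗ[A] (M ⊔ S i : Submodule A V) :=
      (LinearEquiv.ofInjective e₀ hinj).trans (LinearEquiv.ofEq _ _ hrange)
    have := finiteDimensional_hom_of_tower k A M X
    have := finiteDimensional_hom_of_tower k A (S i) X
    have := finiteDimensional_hom_of_tower k A X M
    have := finiteDimensional_hom_of_tower k A X (S i)
    have h₁ : finrank k (M ⊔ S i : Submodule A V) = finrank k M + finrank k (S i) := by
      rw [← (e.restrictScalars k).finrank_eq, finrank_prod]
    have h₂ : finrank k ((M ⊔ S i : Submodule A V) →ₗ[A] X) =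
        finrank k (M →ₗ[A] X) + finrank k (S i →ₗ[A] X) := by
      rw [← (semilinearHomCongr AlgEquiv.refl (e.restrictScalars k) (by simp)
        (LinearEquiv.refl k X) (by simp)).finrank_eq, ← (LinearMap.coprodEquiv k).finrank_eq,
        finrank_prod]
    have h₃ : finrank k (X →ₗ[A] (M ⊔ S i : Submodule A V)) =
        finrank k (X →ₗ[A] M) + finrank k (X →ₗ[A] S i) := by
      rw [← (semilinearHomCongr AlgEquiv.refl (LinearEquiv.refl k X) (by simp)
        (e.restrictScalars k) (by simp)).finrank_eq, ← (LinearMap.prodEquiv k).finrank_eq,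
        finrank_prod]
    obtain ⟨h₄, h₅⟩ := hM
    constructor
    · rw [h₁, h₂, mul_add, add_mul, h₄, ha, hb]
    · rw [h₁, h₃, mul_add, add_mul, h₅, ha, hc]
  obtain rfl : M = ⊤ := top_le_iff.1 (htop ▸ iSup_le hle)
  obtain ⟨h₁, h₂⟩ := hM
  let e : (⊤ : Submodule A V) ≃ₗ[A] V := Submodule.topEquiv
  rw [(semilinearHomCongr AlgEquiv.refl (e.restrictScalars k) (by simp)
    (LinearEquiv.refl k X) (by simp)).finrank_eq, (e.restrictScalars k).finrank_eq] at h₁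
  rw [(semilinearHomCongr AlgEquiv.refl (LinearEquiv.refl k X) (by simp)
    (e.restrictScalars k) (by simp)).finrank_eq, (e.restrictScalars k).finrank_eq] at h₂
  exact ⟨h₁, h₂⟩

end SimpleSubmodules

section Clifford

variable {V : Type*} [AddCommGroup V] [Module ℂ V] {W : Type*} [AddCommGroup W] [Module ℂ W]
  {X : Type*} [AddCommGroup X] [Module ℂ X]

/-- The restriction of a representation to a subgroup, as a module over the group algebra. -/
abbrev resModule (H : Subgroup G) (ρ : Representation ℂ G V) : Type _ :=
  Representation.asModule (ρ.comp H.subtype)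

theorem resModule_single_smul (H : Subgroup G) (ρ : Representation ℂ G V) (h : H) (x : V) :
    (MonoidAlgebra.single h (1 : ℂ) • (show resModule H ρ from x) : resModule H ρ) = ρ h x :=
  (Representation.single_smul (ρ := ρ.comp H.subtype) 1 h _).trans (one_smul ℂ _)

/-- Compatibility of a linear map with the group algebra can be checked on group elements. -/
theorem map_smul_of_map_single_smul {H M N : Type*} [Group H]
    [AddCommGroup M] [Module ℂ M] [Module (MonoidAlgebra ℂ H) M]
    [IsScalarTower ℂ (MonoidAlgebra ℂ H) M] [AddCommGroup N] [Module ℂ N]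
    [Module (MonoidAlgebra ℂ H) N] [IsScalarTower ℂ (MonoidAlgebra ℂ H) N]
    (σ : MonoidAlgebra ℂ H ≃ₐ[ℂ] MonoidAlgebra ℂ H) (F : M →ₗ[ℂ] N) (x : M)
    (hF : ∀ h : H, F (MonoidAlgebra.single h (1 : ℂ) • x) =
      σ (MonoidAlgebra.single h 1) • F x)
    (a : MonoidAlgebra ℂ H) : F (a • x) = σ a • F x := by
  induction a using MonoidAlgebra.induction_linear with
  | zero => simp
  | add a b ha hb => rw [add_smul, map_add, map_add, add_smul, ha, hb]
  | single h c =>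
    have hc : MonoidAlgebra.single h c = c • MonoidAlgebra.single h (1 : ℂ) := by simp
    rw [hc, smul_assoc, map_smul F, map_smul σ, smul_assoc, hF]

/-- Intertwining maps for `H` are linear maps over the group algebra of `H`. -/
noncomputable def homSpaceEquiv (H : Subgroup G) (ρ : Representation ℂ G V)
    (τ : Representation ℂ G X) :
    homSpace H ρ τ ≃ₗ[ℂ] (resModule H ρ →ₗ[MonoidAlgebra ℂ H] resModule H τ) where
  toFun f :=
    { toFun := f.1
      map_add' := map_add f.1
      map_smul' := fun a x => map_smul_of_map_single_smul AlgEquiv.refl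
        (show resModule H ρ →ₗ[ℂ] resModule H τ from f.1) x (fun h =>
          (congrArg f.1 (resModule_single_smul H ρ h x)).trans
            ((f.2 h h.2 x).trans (resModule_single_smul H τ h (f.1 x)).symm)) a }
  invFun f := ⟨f.restrictScalars ℂ, fun h hh x =>
    (congrArg f (resModule_single_smul H ρ ⟨h, hh⟩ x)).symm.trans
      ((f.map_smul _ _).trans (resModule_single_smul H τ ⟨h, hh⟩ (f x)))⟩
  map_add' _ _ := rfl
  map_smul' _ _ := rfl
  left_inv _ := rfl
  right_inv _ := rfl

/-- The automorphism of the group algebra of a normal subgroup given by conjugation. -/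
noncomputable def conjAlgEquiv (H : Subgroup G) [H.Normal] (g : G) :
    MonoidAlgebra ℂ H ≃ₐ[ℂ] MonoidAlgebra ℂ H :=
  MonoidAlgebra.domCongr ℂ ℂ (MulAut.conjNormal g)

/-- The action of a group element on the restriction to a subgroup. -/
noncomputable def actEquiv (H : Subgroup G) (ρ : Representation ℂ G V) (g : G) :
    resModule H ρ ≃ₗ[ℂ] resModule H ρ :=
  LinearEquiv.ofBijective (M := V) (M₂ := V) (ρ g) (ρ.apply_bijective g)

theorem actEquiv_smul (H : Subgroup G) [H.Normal] (ρ : Representation ℂ G V) (g : G)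
    (a : MonoidAlgebra ℂ H) (x : resModule H ρ) :
    actEquiv H ρ g (a • x) = conjAlgEquiv H g a • actEquiv H ρ g x := by
  refine map_smul_of_map_single_smul (conjAlgEquiv H g) (actEquiv H ρ g).toLinearMap x
    (fun h => ?_) a
  have h₁ : conjAlgEquiv H g (MonoidAlgebra.single h 1) =
      MonoidAlgebra.single (MulAut.conjNormal g h) 1 := by
    simp [conjAlgEquiv]
  have h₂ (y : V) : ρ g (ρ h y) = ρ (MulAut.conjNormal g h : H) (ρ g y) := by
    rw [MulAut.conjNormal_apply, map_mul, map_mul]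
    simp
  rw [h₁]
  exact (congrArg (actEquiv H ρ g) (resModule_single_smul H ρ h x)).trans
    ((h₂ x).trans (resModule_single_smul H ρ _ (ρ g x)).symm)

/-- The `g`-translate of an `H`-stable subspace. -/
noncomputable abbrev gTranslate (H : Subgroup G) [H.Normal] (ρ : Representation ℂ G V)
    (S : Submodule (MonoidAlgebra ℂ H) (resModule H ρ)) (g : G) :
    Submodule (MonoidAlgebra ℂ H) (resModule H ρ) :=
  S.translate (conjAlgEquiv H g) (actEquiv H ρ g) (actEquiv_smul H ρ g)

theorem iSup_gTranslate_eq_top (H : Subgroup G) [H.Normal] {ρ : Representation ℂ G V}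
    (hρ : IsIrrep ρ) {S : Submodule (MonoidAlgebra ℂ H) (resModule H ρ)} (hS : S ≠ ⊥) :
    ⨆ g, gTranslate H ρ S g = ⊤ := by
  obtain ⟨T, hT⟩ : ∃ T : Submodule ℂ V, T = S.restrictScalars ℂ := ⟨_, rfl⟩
  let p : Submodule ℂ V := ⨆ g, Submodule.map (ρ g) T
  have hp : ∀ g : G, ∀ x ∈ p, ρ g x ∈ p := by
    intro g
    change p ≤ p.comap (ρ g)
    refine iSup_le fun g' => ?_
    rw [← Submodule.map_le_iff_le_comap, ← Submodule.map_comp]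
    have : ρ g ∘ₗ ρ g' = ρ (g * g') := (map_mul ρ g g').symm
    rw [this]
    exact le_iSup (fun g => Submodule.map (ρ g) T) (g * g')
  have hpT : p ≤ (⨆ g, gTranslate H ρ S g).restrictScalars ℂ :=
    iSup_le fun g => by
      rw [hT]
      exact le_iSup (gTranslate H ρ S) g
  rcases hρ.2 p hp with h | h
  · have hle : T ≤ p := by
      have h₁ := le_iSup (fun g => Submodule.map (ρ g) T) 1
      simpa only [map_one, Module.End.one_eq_id, Submodule.map_id] using h₁
    rw [h, hT] at hle
    exact absurd ((Submodule.eq_bot_iff S).2 fun x hx => hle hx) hS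
  · exact (Submodule.eq_top_iff').2 fun x => hpT (h ▸ Submodule.mem_top)

/-- Clifford theory: dimensions of spaces of `H`-homomorphisms to and from an irreducible
representation can be read off from a simple `H`-constituent. -/
theorem finrank_mul_finrank_homSpace (H : Subgroup G) [H.Normal] [FiniteDimensional ℂ V]
    [FiniteDimensional ℂ X] {ρ : Representation ℂ G V} (hρ : IsIrrep ρ)
    (τ : Representation ℂ G X) (S : Submodule (MonoidAlgebra ℂ H) (resModule H ρ))
    [IsSimpleModule (MonoidAlgebra ℂ H) S] :
    finrank ℂ S * finrank ℂ (homSpace H ρ τ) =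
        finrank ℂ V * finrank ℂ (S →ₗ[MonoidAlgebra ℂ H] resModule H τ) ∧
      finrank ℂ S * finrank ℂ (homSpace H τ ρ) =
        finrank ℂ V * finrank ℂ (resModule H τ →ₗ[MonoidAlgebra ℂ H] S) := by
  have hS : S ≠ ⊥ := (isSimpleModule_iff_isAtom.1 inferInstance).1
  rw [(homSpaceEquiv H ρ τ).finrank_eq, (homSpaceEquiv H τ ρ).finrank_eq]
  let e (g : G) := S.translateEquiv (conjAlgEquiv H g) (actEquiv H ρ g) (actEquiv_smul H ρ g)
  have he (g : G) := S.translateEquiv_smul (conjAlgEquiv H g) (actEquiv H ρ g)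
    (actEquiv_smul H ρ g)
  exact finrank_hom_of_iSup_simple_eq_top (k := ℂ) (gTranslate H ρ S)
    (fun g => IsSimpleModule.of_semilinear (conjAlgEquiv H g) (e g) (he g))
    (iSup_gTranslate_eq_top H hρ hS) (fun g => (e g).finrank_eq.symm)
    (fun g => (semilinearHomCongr (conjAlgEquiv H g) (e g) (he g)
      (actEquiv H τ g) (actEquiv_smul H τ g)).finrank_eq.symm)
    (fun g => (semilinearHomCongr (conjAlgEquiv H g) (actEquiv H τ g) (actEquiv_smul H τ g)
      (e g) (he g)).finrank_eq.symm)

/-- If two irreducible representations of `G` have a nonzero `H`-homomorphism between them, then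
their restrictions to the normal subgroup `H` are proportional. -/
theorem finrank_homSpace_proportional (H : Subgroup G) [H.Normal] [FiniteDimensional ℂ V]
    [FiniteDimensional ℂ W] [FiniteDimensional ℂ X] {ρ : Representation ℂ G V}
    {σ : Representation ℂ G W} (hρ : IsIrrep ρ) (hσ : IsIrrep σ)
    (hne : finrank ℂ (homSpace H ρ σ) ≠ 0) (τ : Representation ℂ G X) :
    finrank ℂ W * finrank ℂ (homSpace H ρ τ) = finrank ℂ V * finrank ℂ (homSpace H σ τ) ∧
      finrank ℂ W * finrank ℂ (homSpace H τ ρ) =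
        finrank ℂ V * finrank ℂ (homSpace H τ σ) := by
  have : Nontrivial (resModule H ρ) := hρ.1
  have : IsArtinian (MonoidAlgebra ℂ H) (resModule H ρ) := isArtinian_of_tower ℂ inferInstance
  obtain ⟨S₀, hS₀, -⟩ := (eq_bot_or_exists_atom_le
    (⊤ : Submodule (MonoidAlgebra ℂ H) (resModule H ρ))).resolve_left top_ne_bot
  have hS₀s : IsSimpleModule (MonoidAlgebra ℂ H) S₀ := isSimpleModule_iff_isAtom.2 hS₀
  rw [(homSpaceEquiv H ρ σ).finrank_eq] at hne
  have : Nontrivial (resModule H ρ →ₗ[MonoidAlgebra ℂ H] resModule H σ) :=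
    not_subsingleton_iff_nontrivial.1 fun _ => hne finrank_zero_of_subsingleton
  obtain ⟨f, hf⟩ := exists_ne (0 : resModule H ρ →ₗ[MonoidAlgebra ℂ H] resModule H σ)
  obtain ⟨g, hg⟩ : ∃ g, ¬ gTranslate H ρ S₀ g ≤ LinearMap.ker f := by
    by_contra! h
    exact hf (LinearMap.ker_eq_top.1
      (top_le_iff.1 (iSup_gTranslate_eq_top H hρ hS₀.1 ▸ iSup_le h)))
  let S := gTranslate H ρ S₀ g
  have hS : IsSimpleModule (MonoidAlgebra ℂ H) S :=
    IsSimpleModule.of_semilinear (conjAlgEquiv H g) _ (S₀.translateEquiv_smul _ _ _)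
  have hinj : Function.Injective (f.domRestrict S) := by
    refine (LinearMap.injective_or_eq_zero _).resolve_right fun h => hg fun x hx => ?_
    exact LinearMap.congr_fun h ⟨x, hx⟩
  let T := LinearMap.range (f.domRestrict S)
  let e : S ≃ₗ[MonoidAlgebra ℂ H] T := LinearEquiv.ofInjective _ hinj
  have : IsSimpleModule (MonoidAlgebra ℂ H) T := IsSimpleModule.congr e.symm
  have hdim : finrank ℂ S = finrank ℂ T := (e.restrictScalars ℂ).finrank_eq
  have hto : finrank ℂ (S →ₗ[MonoidAlgebra ℂ H] resModule H τ) =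
      finrank ℂ (T →ₗ[MonoidAlgebra ℂ H] resModule H τ) :=
    (semilinearHomCongr AlgEquiv.refl (e.restrictScalars ℂ) (by simp)
      (LinearEquiv.refl ℂ _) (by simp)).finrank_eq
  have hfrom : finrank ℂ (resModule H τ →ₗ[MonoidAlgebra ℂ H] S) =
      finrank ℂ (resModule H τ →ₗ[MonoidAlgebra ℂ H] T) :=
    (semilinearHomCongr AlgEquiv.refl (LinearEquiv.refl ℂ _) (by simp)
      (e.restrictScalars ℂ) (by simp)).finrank_eq
  have hpos : 0 < finrank ℂ S := by
    have : Nontrivial S := IsSimpleModule.nontrivial (MonoidAlgebra ℂ H) S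
    have : FiniteDimensional ℂ S :=
      inferInstanceAs (FiniteDimensional ℂ (S.restrictScalars ℂ))
    exact finrank_pos
  obtain ⟨h₁, h₂⟩ := finrank_mul_finrank_homSpace H hρ τ S
  obtain ⟨h₃, h₄⟩ := finrank_mul_finrank_homSpace H hσ τ T
  rw [← hdim] at h₃ h₄
  rw [← hto] at h₃
  rw [← hfrom] at h₄
  constructor <;> apply Nat.eq_of_mul_eq_mul_left hpos
  · rw [mul_left_comm, h₁, mul_left_comm (finrank ℂ S), h₃]
    exact mul_left_comm _ _ _
  · rw [mul_left_comm, h₂, mul_left_comm (finrank ℂ S), h₄]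
    exact mul_left_comm _ _ _

end Clifford

theorem homSpace_mono {V₁ V₂ : Type*} [AddCommGroup V₁] [Module ℂ V₁] [AddCommGroup V₂]
    [Module ℂ V₂] (ρ₁ : Representation ℂ G V₁) (ρ₂ : Representation ℂ G V₂) {H K : Subgroup G}
    (hHK : H ≤ K) : homSpace K ρ₁ ρ₂ ≤ homSpace H ρ₁ ρ₂ :=
  fun _ hf h hh => hf h (hHK hh)

theorem invW_mul_le_invW_mul {V W X Y : Type*} [AddCommGroup V] [Module ℂ V] [AddCommGroup W]
    [Module ℂ W] [AddCommGroup X] [Module ℂ X] [AddCommGroup Y] [Module ℂ Y]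
    (U : ℕ → Subgroup G) (w : ℕ → ℝ≥0) {ρ : Representation ℂ G V} {σ : Representation ℂ G W}
    {ρ' : Representation ℂ G X} {σ' : Representation ℂ G Y} {a b : ℕ}
    (h : ∀ m, finrank ℂ (homSpace (U m) ρ σ) * a ≤ finrank ℂ (homSpace (U m) ρ' σ') * b) :
    invW U w ρ σ * a ≤ invW U w ρ' σ' * b := by
  rw [invW, invW, ← ENNReal.tsum_mul_right, ← ENNReal.tsum_mul_right]
  refine ENNReal.tsum_le_tsum fun m => ?_
  rw [mul_assoc, mul_assoc]
  exact mul_le_mul_right (mod_cast h (m + 1)) _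

theorem ftilde_le_ftilde {q v : ℝ} (hq : 1 < q) (hv : 0 < v) {I J : ℝ≥0∞} {a b c d : ℕ}
    (hJ : J < ⊤) (hI : 0 < I) (ha : 0 < a) (hb : 0 < b) (hc : 0 < c) (hd : 0 < d)
    (h : I * (c * d : ℕ) ≤ J * (a * b : ℕ)) :
    ftilde q v J c d ≤ ftilde q v I a b := by
  have hJ_mul : J * (a * b : ℕ) ≠ ⊤ := ENNReal.mul_ne_top hJ.ne (ENNReal.natCast_ne_top _)
  have hI_top : I ≠ ⊤ := by
    rintro rfl
    rw [ENNReal.top_mul (by positivity)] at h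
    exact hJ_mul (top_le_iff.1 h)
  have hr := ENNReal.toReal_mono hJ_mul h
  rw [ENNReal.toReal_mul, ENNReal.toReal_mul, ENNReal.toReal_natCast,
    ENNReal.toReal_natCast] at hr
  push_cast at hr
  have hIr : 0 < I.toReal := ENNReal.toReal_pos hI.ne' hI_top
  have hlog : 0 < Real.log q := Real.log_pos hq
  unfold ftilde
  gcongr ?_ / _
  refine neg_le_neg (Real.log_le_log (by positivity) ?_)
  rw [div_le_div_iff₀ (by positivity) (by positivity), mul_assoc, mul_assoc]
  gcongr

/-- the ultrametric inequality for the normalized conductors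
(the division algebra analogue of the Bushnell–Henniart inequality). -/
theorem stmt11 {V₁ V₂ V₃ : Type*} [AddCommGroup V₁] [Module ℂ V₁] [FiniteDimensional ℂ V₁]
    [AddCommGroup V₂] [Module ℂ V₂] [FiniteDimensional ℂ V₂]
    [AddCommGroup V₃] [Module ℂ V₃] [FiniteDimensional ℂ V₃]
    (U : ℕ → Subgroup G) (hU : Antitone U) (hUnormal : ∀ m, (U m).Normal)
    (w : ℕ → ℝ≥0) (q v : ℝ) (hq : 1 < q) (hv : 0 < v)
    (ρ₁ : Representation ℂ G V₁) (ρ₂ : Representation ℂ G V₂) (ρ₃ : Representation ℂ G V₃)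
    (h₁ : IsIrrep ρ₁) (h₂ : IsIrrep ρ₂) (h₃ : IsIrrep ρ₃)
    (hfin11 : invW U w ρ₁ ρ₁ < ⊤) (hfin12 : invW U w ρ₁ ρ₂ < ⊤) (hfin13 : invW U w ρ₁ ρ₃ < ⊤)
    (hfin21 : invW U w ρ₂ ρ₁ < ⊤) (hfin22 : invW U w ρ₂ ρ₂ < ⊤) (hfin23 : invW U w ρ₂ ρ₃ < ⊤)
    (hfin31 : invW U w ρ₃ ρ₁ < ⊤) (hfin32 : invW U w ρ₃ ρ₂ < ⊤) (hfin33 : invW U w ρ₃ ρ₃ < ⊤)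
    (hpos12 : 0 < invW U w ρ₁ ρ₂) (hpos23 : 0 < invW U w ρ₂ ρ₃) :
    0 < invW U w ρ₁ ρ₃ ∧
      ftilde q v (invW U w ρ₁ ρ₃) (Module.finrank ℂ V₁) (Module.finrank ℂ V₃) ≤
        max (ftilde q v (invW U w ρ₁ ρ₂) (Module.finrank ℂ V₁) (Module.finrank ℂ V₂))
          (ftilde q v (invW U w ρ₂ ρ₃) (Module.finrank ℂ V₂) (Module.finrank ℂ V₃)) := by
  have := h₁.1
  have := h₂.1
  have := h₃.1
  have hd₁ : 0 < finrank ℂ V₁ := finrank_pos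
  have hd₂ : 0 < finrank ℂ V₂ := finrank_pos
  have hd₃ : 0 < finrank ℂ V₃ := finrank_pos
  have key₁₂ (m : ℕ) (hm : finrank ℂ (homSpace (U m) ρ₁ ρ₂) ≠ 0) :=
    (finrank_homSpace_proportional (U m) h₁ h₂ hm ρ₃).1
  have key₂₃ (m : ℕ) (hm : finrank ℂ (homSpace (U m) ρ₂ ρ₃) ≠ 0) :=
    (finrank_homSpace_proportional (U m) h₂ h₃ hm ρ₁).2
  have pos_of_le {I J : ℝ≥0∞} {a b : ℕ} (hI : 0 < I) (ha : 0 < a) (h : I * a ≤ J * b) :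
      0 < J := by
    refine pos_iff_ne_zero.2 fun hJ => ?_
    rw [hJ, zero_mul, nonpos_iff_eq_zero, mul_eq_zero] at h
    exact h.elim hI.ne' (Nat.cast_ne_zero.2 ha.ne')
  have hcases : (∀ m, finrank ℂ (homSpace (U m) ρ₁ ρ₂) ≠ 0 →
        finrank ℂ (homSpace (U m) ρ₂ ρ₃) ≠ 0) ∨
      ∀ m, finrank ℂ (homSpace (U m) ρ₂ ρ₃) ≠ 0 → finrank ℂ (homSpace (U m) ρ₁ ρ₂) ≠ 0 := by
    by_contra! h
    obtain ⟨⟨m, hm₁, hm₂⟩, n, hn₁, hn₂⟩ := h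
    rcases le_total m n with hmn | hmn
    · have := Submodule.finrank_mono (homSpace_mono ρ₁ ρ₂ (hU hmn))
      omega
    · have := Submodule.finrank_mono (homSpace_mono ρ₂ ρ₃ (hU hmn))
      omega
  rcases hcases with hcase | hcase
  · have hle : invW U w ρ₁ ρ₂ * (finrank ℂ V₃ : ℕ) ≤ invW U w ρ₁ ρ₃ * (finrank ℂ V₂ : ℕ) := by
      refine invW_mul_le_invW_mul U w fun m => ?_
      by_cases hm : finrank ℂ (homSpace (U m) ρ₁ ρ₂) = 0
      · simp [hm]
      · linarith [key₂₃ m (hcase m hm)]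
    refine ⟨pos_of_le hpos12 hd₃ hle, le_max_of_le_left ?_⟩
    refine ftilde_le_ftilde hq hv hfin13 hpos12 hd₁ hd₂ hd₁ hd₃ ?_
    rw [Nat.cast_mul, Nat.cast_mul, mul_left_comm, mul_left_comm _ (finrank ℂ V₁ : ℝ≥0∞)]
    gcongr
  · have hle : invW U w ρ₂ ρ₃ * (finrank ℂ V₁ : ℕ) ≤ invW U w ρ₁ ρ₃ * (finrank ℂ V₂ : ℕ) := by
      refine invW_mul_le_invW_mul U w fun m => ?_
      by_cases hm : finrank ℂ (homSpace (U m) ρ₂ ρ₃) = 0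
      · simp [hm]
      · linarith [key₁₂ m (hcase m hm)]
    refine ⟨pos_of_le hpos23 hd₁ hle, le_max_of_le_right ?_⟩
    refine ftilde_le_ftilde hq hv hfin13 hpos23 hd₂ hd₃ hd₁ hd₃ ?_
    rw [Nat.cast_mul, Nat.cast_mul, ← mul_assoc, ← mul_assoc]
    gcongr
end

section
/- Let G be a group, (U_m)_{m≥0} a decreasing sequence of normal subgroups of G, and w : ℕ → [0, ∞) a family of nonnegative real weights. For irreducible finite-dimensional complex representations π, π' of G set inv(π, π') := Σ_{m=1}^∞ w_m · dim Hom_{U_m}(π, π') (a sum in [0, ∞]). Fix real numbers q > 1 and v > 0, and for a pair with 0 < inv(π, π') < ∞ define the normalized conductor f̃(π, π') := −log( v² · inv(π, π') / (d_π d_{π'}) ) / log q. Let π₁, π₂ be irreducible finite-dimensional complex representations of G such that inv(π₁, π₁), inv(π₂, π₂) and inv(π₁, π₂) are all finite and inv(π₁, π₂) > 0. Then inv(π₁, π₁) > 0, inv(π₂, π₂) > 0, and f̃(π₁, π₂) ≥ max( f̃(π₁, π₁), f̃(π₂, π₂) ). -/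
variable {G : Type*} [Group G]

open scoped ENNReal NNReal

section Clifford

variable {V V' W : Type*} [AddCommGroup V] [Module ℂ V] [AddCommGroup V'] [Module ℂ V']
  [AddCommGroup W] [Module ℂ W]

/-- The subspace `p` is stable under the subgroup `N`. -/
def IsStable (N : Subgroup G) (ρ : Representation ℂ G V) (p : Submodule ℂ V) : Prop :=
  ∀ n ∈ N, ∀ x ∈ p, ρ n x ∈ p

/-- The `N`-intertwining maps whose values lie in the subspace `p`. -/
def homInto (N : Subgroup G) (ρW : Representation ℂ G W) (ρ : Representation ℂ G V)
    (p : Submodule ℂ V) : Submodule ℂ (W →ₗ[ℂ] V) where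
  carrier := {f | f ∈ homSpace N ρW ρ ∧ ∀ x, f x ∈ p}
  add_mem' hf hg := ⟨add_mem hf.1 hg.1, fun x => p.add_mem (hf.2 x) (hg.2 x)⟩
  zero_mem' := ⟨zero_mem _, fun _ => p.zero_mem⟩
  smul_mem' c _ hf := ⟨Submodule.smul_mem _ c hf.1, fun x => p.smul_mem c (hf.2 x)⟩

theorem homInto_top (N : Subgroup G) (ρW : Representation ℂ G W) (ρ : Representation ℂ G V) :
    homInto N ρW ρ ⊤ = homSpace N ρW ρ :=
  Submodule.ext fun _ => ⟨fun h => h.1, fun h => ⟨h, fun _ => trivial⟩⟩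

theorem homInto_bot (N : Subgroup G) (ρW : Representation ℂ G W) (ρ : Representation ℂ G V) :
    homInto N ρW ρ ⊥ = ⊥ :=
  (Submodule.eq_bot_iff _).2 fun _ h => LinearMap.ext fun x => (Submodule.mem_bot ℂ).1 (h.2 x)

theorem finrank_le_of_mapsTo_of_injOn [FiniteDimensional ℂ V'] (L : V →ₗ[ℂ] V')
    {A : Submodule ℂ V} {B : Submodule ℂ V'} (hmaps : ∀ x ∈ A, L x ∈ B)
    (hinj : ∀ x ∈ A, L x = 0 → x = 0) : Module.finrank ℂ A ≤ Module.finrank ℂ B := by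
  refine LinearMap.finrank_le_finrank_of_injective (f := L.restrict hmaps) ?_
  rw [injective_iff_map_eq_zero]
  rintro ⟨x, hx⟩ h
  exact Subtype.ext (hinj x hx (congrArg Subtype.val h))

theorem finrank_homInto_sup [FiniteDimensional ℂ V] [FiniteDimensional ℂ W] {N : Subgroup G}
    (ρW : Representation ℂ G W) (ρ : Representation ℂ G V) {p q : Submodule ℂ V}
    (hp : IsStable N ρ p) (hq : IsStable N ρ q) (hpq : Disjoint p q) :
    Module.finrank ℂ (homInto N ρW ρ (p ⊔ q)) =
      Module.finrank ℂ (homInto N ρW ρ p) + Module.finrank ℂ (homInto N ρW ρ q) := by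
  obtain ⟨P, hPp, hPq⟩ : ∃ P : V →ₗ[ℂ] V, (∀ x ∈ p, P x = x) ∧ ∀ x ∈ q, P x = 0 := by
    obtain ⟨q', hqq', hc⟩ := hpq.symm.exists_isCompl
    exact ⟨p.projection q' hc.symm, fun x hx => Submodule.projection_apply_of_mem_left _ hx,
      fun x hx => Submodule.projection_apply_of_mem_right _ (hqq' hx)⟩
  have hPmem : ∀ x ∈ p ⊔ q, P x ∈ p ∧ x - P x ∈ q := by
    intro x hx
    obtain ⟨y, hy, z, hz, rfl⟩ := Submodule.mem_sup.1 hx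
    simp [map_add, hPp y hy, hPq z hz, hy, hz]
  have hPcomm : ∀ n ∈ N, ∀ x ∈ p ⊔ q, P (ρ n x) = ρ n (P x) := by
    intro n hn x hx
    obtain ⟨y, hy, z, hz, rfl⟩ := Submodule.mem_sup.1 hx
    simp [map_add, hPp y hy, hPq z hz, hPp _ (hp n hn y hy), hPq _ (hq n hn z hz)]
  have hsup : homInto N ρW ρ p ⊔ homInto N ρW ρ q = homInto N ρW ρ (p ⊔ q) := by
    refine le_antisymm (sup_le (fun f hf => ⟨hf.1, fun x => le_sup_left (a := p) (hf.2 x)⟩)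
      fun f hf => ⟨hf.1, fun x => le_sup_right (b := q) (hf.2 x)⟩) fun f hf => ?_
    have hPf : P ∘ₗ f ∈ homInto N ρW ρ p := by
      refine ⟨fun n hn x => ?_, fun x => (hPmem _ (hf.2 x)).1⟩
      simp [hf.1 n hn x, hPcomm n hn _ (hf.2 x)]
    refine Submodule.mem_sup.2 ⟨P ∘ₗ f, hPf, f - P ∘ₗ f,
      ⟨sub_mem hf.1 hPf.1, fun x => (hPmem _ (hf.2 x)).2⟩, add_sub_cancel _ _⟩
  have hinf : homInto N ρW ρ p ⊓ homInto N ρW ρ q = ⊥ :=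
    (Submodule.eq_bot_iff _).2 fun f hf => LinearMap.ext fun x =>
      Submodule.disjoint_def.1 hpq _ (hf.1.2 x) (hf.2.2 x)
  have h := Submodule.finrank_sup_add_finrank_inf_eq (homInto N ρW ρ p) (homInto N ρW ρ q)
  rwa [hsup, hinf, finrank_bot, add_zero] at h

theorem IsStable.map {N : Subgroup G} (hN : N.Normal) {ρ : Representation ℂ G V}
    {p : Submodule ℂ V} (hp : IsStable N ρ p) (g : G) : IsStable N ρ (p.map (ρ g)) := by
  rintro n hn _ ⟨x, hx, rfl⟩
  refine ⟨ρ (g⁻¹ * n * g) x, hp _ ?_ x hx, ?_⟩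
  · simpa using hN.conj_mem n hn g⁻¹
  · simp only [← Module.End.mul_apply, ← map_mul]
    congr 2
    group

theorem map_map_inv (ρ : Representation ℂ G V) (p : Submodule ℂ V) (g : G) :
    (p.map (ρ g)).map (ρ g⁻¹) = p := by
  rw [← Submodule.map_comp, ← Module.End.mul_eq_comp, ← map_mul, inv_mul_cancel, map_one]
  exact Submodule.map_id p

theorem finrank_homInto_map_le [FiniteDimensional ℂ V] [FiniteDimensional ℂ W] {N : Subgroup G}
    (hN : N.Normal) (ρW : Representation ℂ G W) (ρ : Representation ℂ G V) (p : Submodule ℂ V)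
    (g : G) :
    Module.finrank ℂ (homInto N ρW ρ p) ≤ Module.finrank ℂ (homInto N ρW ρ (p.map (ρ g))) := by
  refine finrank_le_of_mapsTo_of_injOn (Representation.linHom ρW ρ g) ?_ fun f _ h => ?_
  · rintro f ⟨hf, hfp⟩
    refine ⟨fun n hn x => ?_, fun x => ⟨_, hfp _, rfl⟩⟩
    have h := hf (g⁻¹ * n * g) (by simpa using hN.conj_mem n hn g⁻¹) (ρW g⁻¹ x)
    simp only [Representation.linHom_apply, LinearMap.comp_apply]
    rw [← Module.End.mul_apply, ← map_mul] at h ⊢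
    have e : g⁻¹ * n * g * g⁻¹ = g⁻¹ * n := by group
    rw [e] at h
    rw [h]
    simp only [← Module.End.mul_apply, ← map_mul]
    congr 2
    group
  · rw [← Representation.inv_self_apply (Representation.linHom ρW ρ) g f, h, map_zero]

theorem finrank_homInto_map [FiniteDimensional ℂ V] [FiniteDimensional ℂ W] {N : Subgroup G}
    (hN : N.Normal) (ρW : Representation ℂ G W) (ρ : Representation ℂ G V) (p : Submodule ℂ V)
    (g : G) :
    Module.finrank ℂ (homInto N ρW ρ (p.map (ρ g))) = Module.finrank ℂ (homInto N ρW ρ p) := by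
  refine le_antisymm ?_ (finrank_homInto_map_le hN ρW ρ p g)
  have h := finrank_homInto_map_le hN ρW ρ (p.map (ρ g)) g⁻¹
  rwa [map_map_inv] at h

theorem finrank_map_rep (ρ : Representation ℂ G V) (p : Submodule ℂ V) (g : G) :
    Module.finrank ℂ (p.map (ρ g)) = Module.finrank ℂ p :=
  (LinearEquiv.finrank_eq (Submodule.equivMapOfInjective (ρ g)
    (Function.LeftInverse.injective (g := ρ g⁻¹) fun x => by simp) p)).symm

/-- A nonzero `N`-stable subspace that is minimal with these properties. -/
def IsMinStable (N : Subgroup G) (ρ : Representation ℂ G V) (p : Submodule ℂ V) : Prop :=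
  IsStable N ρ p ∧ p ≠ ⊥ ∧ ∀ q ≤ p, IsStable N ρ q → q = ⊥ ∨ q = p

theorem exists_isMinStable [FiniteDimensional ℂ V] [Nontrivial V] (N : Subgroup G)
    (ρ : Representation ℂ G V) : ∃ p, IsMinStable N ρ p := by
  obtain ⟨p, hp⟩ := exists_minimal_of_wellFoundedLT
    (fun p : Submodule ℂ V => IsStable N ρ p ∧ p ≠ ⊥) ⟨⊤, fun _ _ _ _ => trivial, top_ne_bot⟩
  refine ⟨p, hp.prop.1, hp.prop.2, fun q hq hs => or_iff_not_imp_left.2 fun h => ?_⟩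
  exact le_antisymm hq (hp.le_of_le ⟨hs, h⟩ hq)

theorem IsMinStable.map {N : Subgroup G} (hN : N.Normal) {ρ : Representation ℂ G V}
    {p : Submodule ℂ V} (hp : IsMinStable N ρ p) (g : G) : IsMinStable N ρ (p.map (ρ g)) := by
  have hinv : ∀ q : Submodule ℂ V, (q.map (ρ g⁻¹)).map (ρ g) = q := fun q => by
    simpa using map_map_inv ρ q g⁻¹
  refine ⟨hp.1.map hN g, fun h => hp.2.1 ?_, fun q hq hs => ?_⟩
  · rw [← map_map_inv ρ p g, h, Submodule.map_bot]
  · have hle : q.map (ρ g⁻¹) ≤ p := map_map_inv ρ p g ▸ Submodule.map_mono hq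
    rcases hp.2.2 _ hle (hs.map hN g⁻¹) with h | h
    · left; rw [← hinv q, h, Submodule.map_bot]
    · right; rw [← hinv q, h]

theorem IsIrrep.eq_top_of_map_le {ρ : Representation ℂ G V} (hρ : IsIrrep ρ)
    {p q : Submodule ℂ V} (hq : q ≠ ⊥) (h : ∀ g, q.map (ρ g) ≤ p) : p = ⊤ := by
  have hle : q ≤ ⨅ g, p.comap (ρ g) := le_iInf fun g => Submodule.map_le_iff_le_comap.1 (h g)
  rcases hρ.2 (⨅ g, p.comap (ρ g)) (fun g x hx => by
    simp only [Submodule.mem_iInf, Submodule.mem_comap] at hx ⊢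
    intro k
    simpa using hx (k * g)) with hb | ht
  · exact absurd (le_bot_iff.1 (hb ▸ hle)) hq
  · refine top_le_iff.1 (ht ▸ (iInf_le _ (1 : G)).trans fun x hx => ?_)
    simpa using hx

/-- An irreducible representation of `G` restricted to a normal subgroup `N` is a direct sum of
conjugates of any minimal `N`-stable subspace; here read off on dimensions of Hom spaces. -/
theorem IsIrrep.finrank_mul_finrank_homSpace [FiniteDimensional ℂ V] [FiniteDimensional ℂ W]
    {N : Subgroup G} (hN : N.Normal) (ρW : Representation ℂ G W) {ρ : Representation ℂ G V}
    (hρ : IsIrrep ρ) {σ : Submodule ℂ V} (hσ : IsMinStable N ρ σ) :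
    Module.finrank ℂ σ * Module.finrank ℂ (homSpace N ρW ρ) =
      Module.finrank ℂ V * Module.finrank ℂ (homInto N ρW ρ σ) := by
  obtain ⟨p, hp⟩ := exists_maximal_of_wellFoundedGT
    (fun p : Submodule ℂ V => IsStable N ρ p ∧
      Module.finrank ℂ σ * Module.finrank ℂ (homInto N ρW ρ p) =
        Module.finrank ℂ p * Module.finrank ℂ (homInto N ρW ρ σ))
    ⟨⊥, fun n _ x hx => by simp_all, by simp [homInto_bot]⟩
  have htop : p = ⊤ := by
    refine hρ.eq_top_of_map_le hσ.2.1 fun g => ?_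
    by_contra hg
    have hm := hσ.map hN g
    have hdisj : Disjoint p (σ.map (ρ g)) := by
      rw [disjoint_iff]
      refine (hm.2.2 _ inf_le_right fun n hn x hx =>
        ⟨hp.prop.1 n hn x hx.1, hm.1 n hn x hx.2⟩).resolve_right fun h => hg (inf_eq_right.1 h)
    refine hg (le_sup_right.trans (hp.le_of_ge (y := p ⊔ σ.map (ρ g)) ⟨?_, ?_⟩ le_sup_left))
    · intro n hn x hx
      obtain ⟨y, hy, z, hz, rfl⟩ := Submodule.mem_sup.1 hx
      rw [map_add]
      exact Submodule.add_mem_sup (hp.prop.1 n hn y hy) (hm.1 n hn z hz)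
    · have h := Submodule.finrank_sup_add_finrank_inf_eq p (σ.map (ρ g))
      rw [hdisj.eq_bot, finrank_bot, add_zero, finrank_map_rep] at h
      rw [finrank_homInto_sup ρW ρ hp.prop.1 hm.1 hdisj, finrank_homInto_map hN, h, mul_add,
        add_mul, hp.prop.2]
  have h := hp.prop.2
  rwa [htop, homInto_top, finrank_top] at h

theorem IsMinStable.map_intertwining {N : Subgroup G} {ρ : Representation ℂ G V}
    {ρ' : Representation ℂ G V'} {σ : Submodule ℂ V} (hσ : IsMinStable N ρ σ)
    {φ : V →ₗ[ℂ] V'} (hφ : φ ∈ homSpace N ρ ρ') (hinj : ∀ x ∈ σ, φ x = 0 → x = 0) :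
    IsMinStable N ρ' (σ.map φ) := by
  refine ⟨?_, fun h => hσ.2.1 ?_, fun q hq hs => ?_⟩
  · rintro n hn _ ⟨x, hx, rfl⟩
    exact ⟨ρ n x, hσ.1 n hn x hx, hφ n hn x⟩
  · exact (Submodule.eq_bot_iff _).2 fun x hx =>
      hinj x hx ((Submodule.eq_bot_iff _).1 h _ ⟨x, hx, rfl⟩)
  · have hqe : (σ ⊓ q.comap φ).map φ = q := by
      refine le_antisymm (Submodule.map_le_iff_le_comap.2 inf_le_right) fun y hy => ?_
      obtain ⟨x, hx, rfl⟩ := hq hy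
      exact ⟨x, ⟨hx, hy⟩, rfl⟩
    rcases hσ.2.2 (σ ⊓ q.comap φ) inf_le_left fun n hn x hx =>
      ⟨hσ.1 n hn x hx.1, by
        rw [SetLike.mem_coe, Submodule.mem_comap, hφ n hn x]; exact hs n hn _ hx.2⟩ with h | h
    · left; rw [← hqe, h, Submodule.map_bot]
    · right; rw [← hqe, h]

theorem finrank_homInto_map_intertwining_le [FiniteDimensional ℂ V] [FiniteDimensional ℂ W]
    {N : Subgroup G} (ρW : Representation ℂ G W) {ρ : Representation ℂ G V}
    {ρ' : Representation ℂ G V'} {σ : Submodule ℂ V} (hσ : IsStable N ρ σ)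
    {φ : V →ₗ[ℂ] V'} (hφ : φ ∈ homSpace N ρ ρ') (hinj : ∀ x ∈ σ, φ x = 0 → x = 0) :
    Module.finrank ℂ (homInto N ρW ρ' (σ.map φ)) ≤ Module.finrank ℂ (homInto N ρW ρ σ) := by
  obtain ⟨ψ, hψ⟩ := (φ ∘ₗ σ.subtype).exists_leftInverse_of_injective
    (LinearMap.ker_eq_bot'.2 fun x hx => Subtype.ext (hinj x x.2 hx))
  have hψφ : ∀ x (hx : x ∈ σ), ψ (φ x) = ⟨x, hx⟩ := fun x hx => LinearMap.congr_fun hψ ⟨x, hx⟩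
  refine finrank_le_of_mapsTo_of_injOn (LinearMap.llcomp ℂ W V' V (σ.subtype ∘ₗ ψ)) ?_ ?_
  · rintro f ⟨hf, hfp⟩
    refine ⟨fun n hn x => ?_, fun x => (ψ (f x)).2⟩
    obtain ⟨y, hy, hyx⟩ := hfp x
    change ((ψ (f (ρW n x)) : σ) : V) = ρ n (ψ (f x) : σ)
    rw [hf n hn x, ← hyx, ← hφ n hn y, hψφ y hy, hψφ _ (hσ n hn y hy)]
  · rintro f ⟨-, hfp⟩ h
    ext x
    obtain ⟨y, hy, hyx⟩ := hfp x
    have hx : ((ψ (f x) : σ) : V) = 0 := LinearMap.congr_fun h x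
    rw [← hyx, hψφ y hy] at hx
    rw [← hyx, show y = 0 from hx, map_zero, LinearMap.zero_apply]

theorem finrank_mul_finrank_homSpace_le [FiniteDimensional ℂ V] [FiniteDimensional ℂ V']
    {N : Subgroup G} (hN : N.Normal) {ρ : Representation ℂ G V} {ρ' : Representation ℂ G V'}
    (hρ : IsIrrep ρ) (hρ' : IsIrrep ρ') :
    Module.finrank ℂ V * Module.finrank ℂ (homSpace N ρ ρ') ≤
      Module.finrank ℂ V' * Module.finrank ℂ (homSpace N ρ ρ) := by
  by_cases hbot : homSpace N ρ ρ' = ⊥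
  · rw [hbot, finrank_bot, mul_zero]
    exact Nat.zero_le _
  obtain ⟨φ, hφ, hφ0⟩ := Submodule.exists_mem_ne_zero_of_ne_bot hbot
  have := hρ.1
  obtain ⟨τ, hτ⟩ := exists_isMinStable N ρ
  obtain ⟨g, hg⟩ : ∃ g, ¬ τ.map (ρ g) ≤ LinearMap.ker φ := by
    by_contra! h
    exact hφ0 (LinearMap.ker_eq_top.1 (hρ.eq_top_of_map_le hτ.2.1 h))
  set σ := τ.map (ρ g)
  have hσ : IsMinStable N ρ σ := hτ.map hN g
  have hinj : ∀ x ∈ σ, φ x = 0 → x = 0 := by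
    have h := (hσ.2.2 (σ ⊓ LinearMap.ker φ) inf_le_left fun n hn x hx =>
      ⟨hσ.1 n hn x hx.1, by
        rw [SetLike.mem_coe, LinearMap.mem_ker, hφ n hn x, LinearMap.mem_ker.1 hx.2, map_zero]⟩).resolve_right
      fun h => hg (inf_eq_left.1 h)
    exact fun x hx h0 => (Submodule.eq_bot_iff _).1 h x ⟨hx, h0⟩
  have hdim : Module.finrank ℂ (σ.map φ) = Module.finrank ℂ σ :=
    le_antisymm (Submodule.finrank_map_le φ σ)
      (finrank_le_of_mapsTo_of_injOn φ (fun x hx => ⟨x, hx, rfl⟩) hinj)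
  have hself := hρ.finrank_mul_finrank_homSpace hN ρ hσ
  have hcross := hρ'.finrank_mul_finrank_homSpace hN ρ (hσ.map_intertwining hφ hinj)
  have hle := finrank_homInto_map_intertwining_le ρ hσ.1 hφ hinj
  rw [hdim] at hcross
  have hpos : 0 < Module.finrank ℂ σ :=
    Nat.pos_of_ne_zero fun h => hσ.2.1 (Submodule.finrank_eq_zero.1 h)
  refine Nat.le_of_mul_le_mul_left ?_ hpos
  calc _ = Module.finrank ℂ V * (Module.finrank ℂ σ * Module.finrank ℂ (homSpace N ρ ρ')) := by
        ring
    _ ≤ Module.finrank ℂ V' * (Module.finrank ℂ V * Module.finrank ℂ (homInto N ρ ρ σ)) := by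
        rw [hcross, mul_left_comm]
        gcongr
    _ = _ := by rw [← hself]; ring

end Clifford

section Dual

theorem transpose_mem_homSpace_dual {V V' : Type*} [AddCommGroup V] [Module ℂ V]
    [AddCommGroup V'] [Module ℂ V'] {N : Subgroup G}
    {ρ : Representation ℂ G V} {ρ' : Representation ℂ G V'} {f : V →ₗ[ℂ] V'} :
    Module.Dual.transpose (R := ℂ) f ∈ homSpace N ρ'.dual ρ.dual ↔ f ∈ homSpace N ρ ρ' := by
  refine ⟨fun h n hn x => ?_, fun h n hn l => ?_⟩
  · refine (Module.forall_dual_apply_eq_zero_iff ℂ _).1 ?_ |> sub_eq_zero.1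
    intro l
    have := LinearMap.congr_fun (h n⁻¹ (inv_mem hn) l) x
    simp only [Module.Dual.transpose_apply, Representation.dual_apply, LinearMap.comp_apply,
      inv_inv] at this
    rw [map_sub, this, sub_self]
  · ext x
    simp [Module.Dual.transpose_apply, h n⁻¹ (inv_mem hn) x]

variable {V V' : Type*} [AddCommGroup V] [Module ℂ V] [FiniteDimensional ℂ V]
  [AddCommGroup V'] [Module ℂ V'] [FiniteDimensional ℂ V']

theorem IsIrrep.dual {ρ : Representation ℂ G V} (hρ : IsIrrep ρ) : IsIrrep ρ.dual := by
  have := hρ.1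
  refine ⟨inferInstance, fun p hp => ?_⟩
  have hdim := Subspace.finrank_add_finrank_dualCoannihilator_eq p
  rcases hρ.2 p.dualCoannihilator fun g x hx => by
    rw [Submodule.mem_dualCoannihilator] at hx ⊢
    intro f hf
    simpa [Module.Dual.transpose_apply] using hx _ (hp g⁻¹ f hf) with h | h
  · right
    rw [h, finrank_bot, add_zero] at hdim
    exact Submodule.eq_top_of_finrank_eq (hdim.trans Subspace.dual_finrank_eq.symm)
  · left
    rw [h, finrank_top] at hdim
    exact Submodule.finrank_eq_zero.1 (by omega)

theorem finrank_homSpace_dual (N : Subgroup G) (ρ : Representation ℂ G V)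
    (ρ' : Representation ℂ G V') :
    Module.finrank ℂ (homSpace N ρ'.dual ρ.dual) = Module.finrank ℂ (homSpace N ρ ρ') := by
  have hinj : Function.Injective (Module.Dual.transpose (R := ℂ) (M := V) (M' := V')) := by
    rw [injective_iff_map_eq_zero]
    intro f hf
    ext x
    exact (Module.forall_dual_apply_eq_zero_iff ℂ _).1 fun l =>
      LinearMap.congr_fun (LinearMap.congr_fun hf l) x
  have hdim : Module.finrank ℂ (V →ₗ[ℂ] V') =
      Module.finrank ℂ (Module.Dual ℂ V' →ₗ[ℂ] Module.Dual ℂ V) := by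
    rw [Module.finrank_linearMap, Module.finrank_linearMap, Subspace.dual_finrank_eq,
      Subspace.dual_finrank_eq, mul_comm]
  have hsurj := (LinearMap.injective_iff_surjective_of_finrank_eq_finrank hdim).1 hinj
  have hmap : (homSpace N ρ ρ').map (Module.Dual.transpose (R := ℂ)) =
      homSpace N ρ'.dual ρ.dual := by
    refine le_antisymm (Submodule.map_le_iff_le_comap.2 fun f hf =>
      transpose_mem_homSpace_dual.2 hf) fun l hl => ?_
    obtain ⟨f, rfl⟩ := hsurj l
    exact ⟨f, transpose_mem_homSpace_dual.1 hl, rfl⟩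
  rw [← hmap]
  exact (LinearEquiv.finrank_eq (Submodule.equivMapOfInjective _ hinj _)).symm

theorem finrank_mul_finrank_homSpace_le_right {N : Subgroup G} (hN : N.Normal)
    {ρ : Representation ℂ G V} {ρ' : Representation ℂ G V'} (hρ : IsIrrep ρ)
    (hρ' : IsIrrep ρ') :
    Module.finrank ℂ V' * Module.finrank ℂ (homSpace N ρ ρ') ≤
      Module.finrank ℂ V * Module.finrank ℂ (homSpace N ρ' ρ') := by
  have h := finrank_mul_finrank_homSpace_le hN hρ'.dual hρ.dual
  rwa [finrank_homSpace_dual, finrank_homSpace_dual, Subspace.dual_finrank_eq,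
    Subspace.dual_finrank_eq] at h

end Dual

theorem mul_invW_le_mul_invW {V₁ V₂ V₃ V₄ : Type*} [AddCommGroup V₁] [Module ℂ V₁]
    [AddCommGroup V₂] [Module ℂ V₂] [AddCommGroup V₃] [Module ℂ V₃] [AddCommGroup V₄]
    [Module ℂ V₄] (U : ℕ → Subgroup G) (w : ℕ → ℝ≥0) {ρ₁ : Representation ℂ G V₁}
    {ρ₂ : Representation ℂ G V₂} {ρ₃ : Representation ℂ G V₃} {ρ₄ : Representation ℂ G V₄}
    {a b : ℕ} (h : ∀ m, a * Module.finrank ℂ (homSpace (U m) ρ₁ ρ₂) ≤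
      b * Module.finrank ℂ (homSpace (U m) ρ₃ ρ₄)) :
    (a : ℝ≥0∞) * invW U w ρ₁ ρ₂ ≤ b * invW U w ρ₃ ρ₄ := by
  simp only [invW, ← ENNReal.tsum_mul_left]
  refine ENNReal.tsum_le_tsum fun m => ?_
  rw [mul_left_comm, mul_left_comm (b : ℝ≥0∞)]
  exact mul_le_mul_right (by exact_mod_cast h (m + 1)) _

theorem pos_and_log_le {v : ℝ} (hv : 0 < v) {I J : ℝ≥0∞} {a b : ℕ} (ha : 0 < a) (hb : 0 < b)
    (hI : I < ⊤) (hJ : J < ⊤) (hIpos : 0 < I) (h : (a : ℝ≥0∞) * I ≤ b * J) :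
    0 < J ∧ Real.log (v ^ 2 * I.toReal / ((a : ℝ) * b)) ≤
      Real.log (v ^ 2 * J.toReal / ((a : ℝ) * a)) := by
  have hIr : 0 < I.toReal := ENNReal.toReal_pos hIpos.ne' hI.ne
  have ha' : (0 : ℝ) < a := by exact_mod_cast ha
  have hb' : (0 : ℝ) < b := by exact_mod_cast hb
  have hr : (a : ℝ) * I.toReal ≤ b * J.toReal := by
    simpa using ENNReal.toReal_mono (ENNReal.mul_ne_top (ENNReal.natCast_ne_top b) hJ.ne) h
  have hJr : 0 < J.toReal := pos_of_mul_pos_right ((mul_pos ha' hIr).trans_le hr) hb'.le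
  refine ⟨(ENNReal.toReal_pos_iff.1 hJr).1, Real.log_le_log (by positivity) ?_⟩
  rw [div_le_div_iff₀ (by positivity) (by positivity)]
  have := mul_le_mul_of_nonneg_left hr (by positivity : (0 : ℝ) ≤ v ^ 2 * a)
  linarith

/-- `f̃(π₁, π₂) ≥ max(f̃(π₁, π₁), f̃(π₂, π₂))`. -/
theorem stmt12 {V₁ V₂ : Type*} [AddCommGroup V₁] [Module ℂ V₁] [FiniteDimensional ℂ V₁]
    [AddCommGroup V₂] [Module ℂ V₂] [FiniteDimensional ℂ V₂]
    (U : ℕ → Subgroup G) (hU : Antitone U) (hUnormal : ∀ m, (U m).Normal)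
    (w : ℕ → ℝ≥0) (q v : ℝ) (hq : 1 < q) (hv : 0 < v)
    (ρ₁ : Representation ℂ G V₁) (ρ₂ : Representation ℂ G V₂)
    (h₁ : IsIrrep ρ₁) (h₂ : IsIrrep ρ₂)
    (hfin11 : invW U w ρ₁ ρ₁ < ⊤) (hfin22 : invW U w ρ₂ ρ₂ < ⊤)
    (hfin12 : invW U w ρ₁ ρ₂ < ⊤)
    (hpos12 : 0 < invW U w ρ₁ ρ₂) :
    0 < invW U w ρ₁ ρ₁ ∧ 0 < invW U w ρ₂ ρ₂ ∧
      ftilde q v (invW U w ρ₁ ρ₂) (Module.finrank ℂ V₁) (Module.finrank ℂ V₂) ≥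
        max (ftilde q v (invW U w ρ₁ ρ₁) (Module.finrank ℂ V₁) (Module.finrank ℂ V₁))
          (ftilde q v (invW U w ρ₂ ρ₂) (Module.finrank ℂ V₂) (Module.finrank ℂ V₂)) := by
  have := h₁.1
  have := h₂.1
  have hd₁ : 0 < Module.finrank ℂ V₁ := Module.finrank_pos
  have hd₂ : 0 < Module.finrank ℂ V₂ := Module.finrank_pos
  have hlogq : 0 ≤ Real.log q := Real.log_nonneg hq.le
  obtain ⟨hpos11, hlog11⟩ := pos_and_log_le hv hd₁ hd₂ hfin12 hfin11 hpos12
    (mul_invW_le_mul_invW U w fun m => finrank_mul_finrank_homSpace_le (hUnormal m) h₁ h₂)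
  obtain ⟨hpos22, hlog22⟩ := pos_and_log_le hv hd₂ hd₁ hfin12 hfin22 hpos12
    (mul_invW_le_mul_invW U w fun m => finrank_mul_finrank_homSpace_le_right (hUnormal m) h₁ h₂)
  rw [mul_comm (Module.finrank ℂ V₂ : ℝ) (Module.finrank ℂ V₁)] at hlog22
  exact ⟨hpos11, hpos22, max_le (div_le_div_of_nonneg_right (neg_le_neg hlog11) hlogq)
    (div_le_div_of_nonneg_right (neg_le_neg hlog22) hlogq)⟩
end
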